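/- For all n ≥ 1 and k ≥ 0, the number of Jacobi permutations of [2n] avoiding 213 with exactly k descents equals (1/n)·C(n, k−n)·C(2n, k+1), and this also equals the number of Jacobi permutations of [2n] avoiding 312 with exactly k descents. For all n ≥ 0 and k ≥ 0, the number of Jacobi permutations of [2n+1] avoiding 213 with exactly k descents equals (1/(n+1))·C(n+1, k−n)·C(2n, k), and this also equals the number of Jacobi permutations of [2n+1] avoiding 312 with exactly k descents. (Here C(a,b) = 0 whenever b < 0 or b > a.) -/

import Mathlib

/-- The length of `ρ_π(π_k)`: the maximal consecutive subword of `π` immediately to the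
right of position `k`, all of whose letters are larger than `π_k`.  Letters of a
permutation of `[n] = {1,…,n}` are modelled by `(π i : ℕ) + 1` for `π : Equiv.Perm (Fin n)`. -/
noncomputable def rhoLen {n : ℕ} (π : Equiv.Perm (Fin n)) (k : Fin n) : ℕ :=
  Nat.card {j : Fin n // k < j ∧ ∀ i : Fin n, k < i → i ≤ j → π k < π i}

/-- A permutation is Jacobi if `ρ_π(π_k)` has even length for every position `k`. -/
def IsJacobi {n : ℕ} (π : Equiv.Perm (Fin n)) : Prop :=
  ∀ k : Fin n, Even (rhoLen π k)

/-- `π` avoids the pattern `123`. -/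
def Avoids123 {n : ℕ} (π : Equiv.Perm (Fin n)) : Prop :=
  ¬ ∃ i j k : Fin n, i < j ∧ j < k ∧ π i < π j ∧ π j < π k

/-- `π` avoids the pattern `132`. -/
def Avoids132 {n : ℕ} (π : Equiv.Perm (Fin n)) : Prop :=
  ¬ ∃ i j k : Fin n, i < j ∧ j < k ∧ π i < π k ∧ π k < π j

/-- `π` avoids the pattern `213`. -/
def Avoids213 {n : ℕ} (π : Equiv.Perm (Fin n)) : Prop :=
  ¬ ∃ i j k : Fin n, i < j ∧ j < k ∧ π j < π i ∧ π i < π k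

/-- `π` avoids the pattern `231`. -/
def Avoids231 {n : ℕ} (π : Equiv.Perm (Fin n)) : Prop :=
  ¬ ∃ i j k : Fin n, i < j ∧ j < k ∧ π k < π i ∧ π i < π j

/-- `π` avoids the pattern `312`. -/
def Avoids312 {n : ℕ} (π : Equiv.Perm (Fin n)) : Prop :=
  ¬ ∃ i j k : Fin n, i < j ∧ j < k ∧ π j < π k ∧ π k < π i

/-- `π` avoids the pattern `321`. -/
def Avoids321 {n : ℕ} (π : Equiv.Perm (Fin n)) : Prop :=
  ¬ ∃ i j k : Fin n, i < j ∧ j < k ∧ π k < π j ∧ π j < π i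

/-- The number of descents of `π`. -/
noncomputable def descCount {n : ℕ} (π : Equiv.Perm (Fin n)) : ℕ :=
  Nat.card {k : Fin n // ∃ h : (k : ℕ) + 1 < n, π ⟨(k : ℕ) + 1, h⟩ < π k}

/-- The binomial coefficient `C(a,b)` for integers, with `C(a,b) = 0` whenever
`b < 0` or `b > a`. -/
def intChoose (a b : ℤ) : ℤ :=
  if 0 ≤ b ∧ b ≤ a then (a.toNat.choose b.toNat : ℤ) else 0

/-- The word of a tree; `true` for 213-avoiders and `false` for 312-avoiders. -/
def treeWord (b : Bool) : BinaryTree Unit → ℕ → List ℕ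
  | .nil, _ => []
  | .node _ l r, s =>
    treeWord b l (if b then s + 1 + r.numNodes else s + 1) ++
      s :: treeWord b r (if b then s + 1 else s + 1 + l.numNodes)

/-- The relation between outer letters of the forbidden pattern. -/
def outerRel (b : Bool) (x z : ℕ) : Prop := if b then x < z else z < x

def listAvoids (b : Bool) (L : List ℕ) : Prop :=
  ∀ x y z, [x, y, z].Sublist L → ¬ (y < x ∧ y < z ∧ outerRel b x z)

def listJacobi : List ℕ → Prop
  | [] => True
  | a :: l => Even (l.takeWhile (fun c => a < c)).length ∧ listJacobi l

def listDesc : List ℕ → ℕ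
  | [] => 0
  | a :: l => (if ∃ c ∈ l.head?, c < a then 1 else 0) + listDesc l

def treeEven : BinaryTree Unit → Prop
  | .nil => True
  | .node _ l r => treeEven l ∧ treeEven r ∧ Even r.numNodes

def treeDesc : BinaryTree Unit → ℕ
  | .nil => 0
  | .node _ l r => treeDesc l + (if l.numNodes = 0 then 0 else 1) + treeDesc r

theorem treeWord_length (b : Bool) (T : BinaryTree Unit) (s : ℕ) :
    (treeWord b T s).length = T.numNodes := by
  induction T generalizing s with
  | nil => simp [treeWord]
  | node _ l r hl hr => simp [treeWord, hl, hr]; omega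

theorem treeWord_perm (b : Bool) (T : BinaryTree Unit) (s : ℕ) :
    (treeWord b T s).Perm (List.range' s T.numNodes) := by
  induction T generalizing s with
  | nil => simp [treeWord]
  | node _ l r hl hr =>
    simp only [treeWord, BinaryTree.numNodes]
    refine List.perm_middle.trans ?_
    rw [List.range'_succ]
    refine List.Perm.cons _ ?_
    cases b
    · simp only [Bool.false_eq_true, if_false]
      refine ((hl _).append (hr _)).trans ?_
      rw [List.range'_append_1]
    · simp only [if_true]
      refine ((hl _).append (hr _)).trans (List.perm_append_comm.trans ?_)
      rw [List.range'_append_1, add_comm r.numNodes]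

theorem mem_treeWord (b : Bool) (T : BinaryTree Unit) (s x : ℕ) :
    x ∈ treeWord b T s ↔ s ≤ x ∧ x < s + T.numNodes := by
  rw [(treeWord_perm b T s).mem_iff, List.mem_range'_1]

theorem takeWhile_stop {p : ℕ → Bool} (l v : List ℕ) (s : ℕ) (h : p s = false) :
    (l ++ s :: v).takeWhile p = l.takeWhile p := by
  induction l with
  | nil => simp [h]
  | cons a l ih => simp only [List.cons_append, List.takeWhile_cons, ih]

theorem listJacobi_split (w v : List ℕ) (s : ℕ) (hw : ∀ x ∈ w, s < x) (hv : ∀ x ∈ v, s < x) :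
    listJacobi (w ++ s :: v) ↔ listJacobi w ∧ listJacobi v ∧ Even v.length := by
  induction w with
  | nil =>
    have : v.takeWhile (fun c => s < c) = v := by
      rw [List.takeWhile_eq_self_iff]; simpa using hv
    simp [listJacobi, this, and_comm]
  | cons a w ih =>
    have ha : s < a := hw a (by simp)
    simp only [List.cons_append, listJacobi]
    rw [ih (fun x hx => hw x (by simp [hx])), takeWhile_stop _ _ _ (by simp; omega)]
    tauto

theorem listDesc_split (w v : List ℕ) (s : ℕ) (hw : ∀ x ∈ w, s < x) (hv : ∀ x ∈ v, s < x) :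
    listDesc (w ++ s :: v) = listDesc w + (if w.length = 0 then 0 else 1) + listDesc v := by
  induction w with
  | nil =>
    have : ¬ ∃ c ∈ v.head?, c < s := by
      rintro ⟨c, hc, h⟩
      have := hv c (List.mem_of_mem_head? hc)
      omega
    simp only [List.nil_append, listDesc, if_neg this]; simp
  | cons a w ih =>
    have ha : s < a := hw a (by simp)
    simp only [List.cons_append, listDesc]
    rw [ih (fun x hx => hw x (by simp [hx]))]
    cases w with
    | nil => simp [listDesc, ha]
    | cons c w => simp; omega

theorem listAvoids_split (b : Bool) (w v : List ℕ) (s : ℕ) (hw : ∀ x ∈ w, s < x)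
    (hv : ∀ x ∈ v, s < x) :
    listAvoids b (w ++ s :: v) ↔
      listAvoids b w ∧ listAvoids b v ∧ ∀ x ∈ w, ∀ z ∈ v, ¬ outerRel b x z := by
  constructor
  · intro h
    refine ⟨fun x y z hs => h x y z (hs.trans (List.sublist_append_left _ _)),
      fun x y z hs => h x y z (hs.trans ((List.sublist_cons_self _ _).trans
        (List.sublist_append_right _ _))), fun x hx z hz hr => ?_⟩
    refine h x s z ?_ ⟨hw x hx, hv z hz, hr⟩
    have h1 : [x].Sublist w := List.singleton_sublist.2 hx
    have h2 : [z].Sublist v := List.singleton_sublist.2 hz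
    exact h1.append (h2.cons_cons s)
  · rintro ⟨h1, h2, h3⟩ x y z hs ⟨hyx, hyz, hr⟩
    have hx : x ∈ w ++ s :: v := hs.subset (by simp)
    have hy : y ∈ w ++ s :: v := hs.subset (by simp)
    obtain ⟨l1, l2, he, hl1, hl2⟩ := List.sublist_append_iff.1 hs
    have hmem : ∀ u ∈ l2, u = s ∨ u ∈ v := fun u hu => by simpa using hl2.subset hu
    have hmin : ∀ u ∈ w ++ s :: v, s ≤ u := by
      intro u hu
      simp only [List.mem_append, List.mem_cons] at hu
      rcases hu with hu | hu | hu
      · exact (hw u hu).le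
      · exact hu.ge
      · exact (hv u hu).le
    have hsy : s ≤ y := hmin y hy
    match l1, he with
    | [], he =>
      simp only [List.nil_append] at he
      subst he
      cases hl2 with
      | cons _ h => exact h2 x y z h ⟨hyx, hyz, hr⟩
      | cons_cons _ h => omega
    | [a], he =>
      simp at he
      obtain ⟨rfl, rfl⟩ := he
      refine h3 x (hl1.subset (by simp)) z ?_ hr
      rcases hmem z (by simp) with h | h
      · omega
      · exact h
    | [a, c], he =>
      simp at he
      obtain ⟨rfl, rfl, rfl⟩ := he
      refine h3 x (hl1.subset (by simp)) z ?_ hr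
      rcases hmem z (by simp) with h | h
      · omega
      · exact h
    | [a, c, d], he =>
      simp at he
      obtain ⟨rfl, rfl, rfl, rfl⟩ := he
      exact h1 _ _ _ hl1 ⟨hyx, hyz, hr⟩
    | a :: c :: d :: e :: l, he => simp at he

theorem treeWord_gt (b : Bool) (T : BinaryTree Unit) (s t : ℕ) (h : s < t) :
    ∀ x ∈ treeWord b T t, s < x := fun x hx => by
  rw [mem_treeWord] at hx; omega

theorem treeWord_jacobi (b : Bool) (T : BinaryTree Unit) (s : ℕ) :
    listJacobi (treeWord b T s) ↔ treeEven T := by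
  induction T generalizing s with
  | nil => simp [treeWord, listJacobi, treeEven]
  | node _ l r hl hr =>
    rw [treeWord, listJacobi_split, hl, hr, treeWord_length, treeEven]
    · apply treeWord_gt; split <;> omega
    · apply treeWord_gt; split <;> omega

theorem treeWord_desc (b : Bool) (T : BinaryTree Unit) (s : ℕ) :
    listDesc (treeWord b T s) = treeDesc T := by
  induction T generalizing s with
  | nil => simp [treeWord, listDesc, treeDesc]
  | node _ l r hl hr =>
    rw [treeWord, listDesc_split, hl, hr, treeWord_length, treeDesc]
    · apply treeWord_gt; split <;> omega
    · apply treeWord_gt; split <;> omega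

theorem treeWord_avoids (b : Bool) (T : BinaryTree Unit) (s : ℕ) :
    listAvoids b (treeWord b T s) := by
  induction T generalizing s with
  | nil => intro x y z h; simp [treeWord] at h
  | node _ l r hl hr =>
    rw [treeWord, listAvoids_split]
    · refine ⟨hl _, hr _, ?_⟩
      intro x hx z hz
      rw [mem_treeWord] at hx hz
      cases b <;> simp [outerRel] at * <;> omega
    · apply treeWord_gt; split <;> omega
    · apply treeWord_gt; split <;> omega

theorem treeWord_inj (b : Bool) (T T' : BinaryTree Unit) (s : ℕ)
    (h : treeWord b T s = treeWord b T' s) : T = T' := by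
  induction T generalizing s T' with
  | nil => cases T' with
    | nil => rfl
    | node _ l r => simp [treeWord] at h
  | node _ l r hl hr => cases T' with
    | nil => simp [treeWord] at h
    | node _ l' r' =>
      simp only [treeWord] at h
      have hn : ∀ (T : BinaryTree Unit) (t : ℕ), s < t → s ∉ treeWord b T t := by
        intro T t ht hx
        exact lt_irrefl _ (treeWord_gt b T s t ht s hx)
      rw [List.append_cons_inj_of_notMem (hn _ _ (by split <;> omega))
        (hn _ _ (by split <;> omega))] at h
      obtain ⟨h1, -, h2⟩ := h
      have e1 : l.numNodes = l'.numNodes := by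
        simpa [treeWord_length] using congrArg List.length h1
      have e2 : r.numNodes = r'.numNodes := by
        simpa [treeWord_length] using congrArg List.length h2
      rw [e2] at h1
      rw [e1] at h2
      rw [hl _ _ h1, hr _ _ h2]

theorem split_perm (w v : List ℕ) (s n : ℕ) (h : (w ++ v).Perm (List.range' s n))
    (hlt : ∀ x ∈ w, ∀ z ∈ v, x ≤ z) :
    w.Perm (List.range' s w.length) ∧ v.Perm (List.range' (s + w.length) v.length) := by
  have hn : n = w.length + v.length := by simpa using h.length_eq.symm
  have hw := List.mergeSort_perm w (fun a b => decide (a ≤ b))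
  have hv := List.mergeSort_perm v (fun a b => decide (a ≤ b))
  have sw : (w.mergeSort (fun a b => decide (a ≤ b))).Pairwise (· ≤ ·) := by
    simpa using List.pairwise_mergeSort (le := fun a b : ℕ => decide (a ≤ b))
      (by simp; intros; omega) (by simp; intros; omega) w
  have sv : (v.mergeSort (fun a b => decide (a ≤ b))).Pairwise (· ≤ ·) := by
    simpa using List.pairwise_mergeSort (le := fun a b : ℕ => decide (a ≤ b))
      (by simp; intros; omega) (by simp; intros; omega) v
  generalize w.mergeSort (fun a b => decide (a ≤ b)) = w' at *
  generalize v.mergeSort (fun a b => decide (a ≤ b)) = v' at *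
  have key : w' ++ v' = List.range' s n := by
    refine List.Perm.eq_of_pairwise (le := (· ≤ ·)) (fun a b _ _ h1 h2 => le_antisymm h1 h2)
      ?_ ?_ ((hw.append hv).trans h)
    · rw [List.pairwise_append]
      exact ⟨sw, sv, fun a ha c hc => hlt a (hw.mem_iff.1 ha) c (hv.mem_iff.1 hc)⟩
    · exact List.pairwise_le_range'
  rw [hn, ← List.range'_append_1] at key
  obtain ⟨k1, k2⟩ := List.append_inj key (by simp [hw.length_eq])
  exact ⟨k1 ▸ hw.symm, k2 ▸ hv.symm⟩

theorem exists_tree (b : Bool) (n : ℕ) : ∀ (L : List ℕ) (s : ℕ), L.Perm (List.range' s n) →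
    listAvoids b L → ∃ T : BinaryTree Unit, treeWord b T s = L ∧ T.numNodes = n := by
  induction n using Nat.strong_induction_on with
  | _ n ih =>
    intro L s hp ha
    rcases n with _ | n
    · exact ⟨.nil, by simpa [treeWord] using hp.symm, rfl⟩
    · have hs : s ∈ L := hp.mem_iff.2 (by simp [List.mem_range'_1])
      obtain ⟨w, v, rfl⟩ := List.append_of_mem hs
      have hp' : (w ++ v).Perm (List.range' (s + 1) n) := by
        have := List.perm_middle.symm.trans hp
        rw [List.range'_succ] at this
        exact this.cons_inv
      have hgt : ∀ x ∈ w ++ v, s < x := fun x hx => by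
        have := hp'.mem_iff.1 hx
        rw [List.mem_range'_1] at this; omega
      have hnd : (w ++ v).Nodup := hp'.nodup_iff.2 List.nodup_range'
      have hne : ∀ x ∈ w, ∀ z ∈ v, x ≠ z := (List.nodup_append.1 hnd).2.2
      rw [listAvoids_split b w v s (fun x hx => hgt x (by simp [hx]))
        (fun x hx => hgt x (by simp [hx]))] at ha
      obtain ⟨aw, av, ho⟩ := ha
      have hn : n = w.length + v.length := by simpa using hp'.length_eq.symm
      cases b
      · obtain ⟨p1, p2⟩ := split_perm w v (s + 1) n hp' (fun x hx z hz => by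
          simpa [outerRel] using ho x hx z hz)
        obtain ⟨l, e1, n1⟩ := ih w.length (by omega) _ _ p1 aw
        obtain ⟨r, e2, n2⟩ := ih v.length (by omega) _ _ p2 av
        refine ⟨.node () l r, ?_, ?_⟩
        · simp [treeWord, e1, n1, e2]
        · simp [n1, n2, hn]
      · obtain ⟨p1, p2⟩ := split_perm v w (s + 1) n (List.perm_append_comm.trans hp')
          (fun x hx z hz => by simpa [outerRel] using ho z hz x hx)
        obtain ⟨l, e1, n1⟩ := ih w.length (by omega) _ _ p2 aw
        obtain ⟨r, e2, n2⟩ := ih v.length (by omega) _ _ p1 av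
        refine ⟨.node () l r, ?_, ?_⟩
        · simp [treeWord, e1, n2, e2]
        · simp [n1, n2, hn]

/-- The word of a permutation. -/
def permWord {n : ℕ} (π : Equiv.Perm (Fin n)) : List ℕ := List.ofFn (fun i => (π i : ℕ))

theorem permWord_inj {n : ℕ} : Function.Injective (permWord (n := n)) := by
  intro π σ h
  have := List.ofFn_injective h
  ext i
  exact congrFun this i

theorem permWord_perm {n : ℕ} (π : Equiv.Perm (Fin n)) :
    (permWord π).Perm (List.range' 0 n) := by
  rw [← List.range_eq_range', List.perm_ext_iff_of_nodup ?_ List.nodup_range]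
  · intro a
    simp only [permWord, List.mem_ofFn, List.mem_range]
    constructor
    · rintro ⟨i, rfl⟩; exact (π i).2
    · intro h; exact ⟨π.symm ⟨a, h⟩, by simp⟩
  · rw [permWord, List.nodup_ofFn]
    intro i j h
    exact π.injective (Fin.ext h)

theorem permWord_surj {n : ℕ} (L : List ℕ) (h : L.Perm (List.range' 0 n)) :
    ∃ π : Equiv.Perm (Fin n), permWord π = L := by
  have hl : L.length = n := by simpa using h.length_eq
  have hnd : L.Nodup := h.nodup_iff.2 List.nodup_range'
  subst hl
  have hlt : ∀ i : Fin L.length, L[i] < L.length := fun i => by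
    have := h.mem_iff.1 (List.getElem_mem i.2)
    rw [List.mem_range'_1] at this; simpa using this.2
  let f : Fin L.length → Fin L.length := fun i => ⟨L[i], hlt i⟩
  have hf : Function.Injective f := by
    intro i j hij
    have : L[i] = L[j] := congrArg Fin.val hij
    exact Fin.ext ((hnd.getElem_inj_iff).1 this)
  refine ⟨Equiv.ofBijective f (Finite.injective_iff_bijective.1 hf), ?_⟩
  simp [permWord, f]

theorem avoids_aux {n : ℕ} (f : Fin n → ℕ) (P : ℕ → ℕ → ℕ → Prop) :
    (∃ x y z, [x, y, z].Sublist (List.ofFn f) ∧ P x y z) ↔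
      ∃ i j k : Fin n, i < j ∧ j < k ∧ P (f i) (f j) (f k) := by
  constructor
  · rintro ⟨x, y, z, hs, hP⟩
    obtain ⟨e, he⟩ := List.sublist_iff_exists_fin_orderEmbedding_get_eq.1 hs
    have hlen : (List.ofFn f).length = n := by simp
    have h0 := he ⟨0, by simp⟩
    have h1 := he ⟨1, by simp⟩
    have h2 := he ⟨2, by simp⟩
    simp at h0 h1 h2
    refine ⟨Fin.cast hlen (e ⟨0, by simp⟩), Fin.cast hlen (e ⟨1, by simp⟩),
      Fin.cast hlen (e ⟨2, by simp⟩), ?_, ?_, ?_⟩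
    · have : e ⟨0, by simp⟩ < e ⟨1, by simp⟩ := e.lt_iff_lt.2 (by simp)
      exact this
    · have : e ⟨1, by simp⟩ < e ⟨2, by simp⟩ := e.lt_iff_lt.2 (by simp)
      exact this
    · convert hP using 1
      · exact h0.symm
      · exact h1.symm
      · exact h2.symm
  · rintro ⟨i, j, k, hij, hjk, hP⟩
    refine ⟨_, _, _, ?_, hP⟩
    have : [f i, f j, f k] = [i, j, k].map f := rfl
    rw [this, List.ofFn_eq_map]
    refine List.Sublist.map _ ?_
    refine List.sublist_of_subperm_of_pairwise (r := (· < ·)) ?_ ?_ ?_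
    · exact List.subperm_of_subset (by simp; omega) (fun a _ => by simp)
    · simp; omega
    · exact List.pairwise_lt_finRange n

theorem avoids213_iff {n : ℕ} (π : Equiv.Perm (Fin n)) :
    Avoids213 π ↔ listAvoids true (permWord π) := by
  have := avoids_aux (fun i => (π i : ℕ)) (fun x y z => y < x ∧ y < z ∧ outerRel true x z)
  rw [Avoids213, ← not_iff_not, not_not]
  simp only [listAvoids, permWord]
  push Not
  rw [this]
  simp only [outerRel, if_true, Fin.lt_def]
  refine exists_congr fun i => exists_congr fun j => exists_congr fun k => ?_
  omega

theorem avoids312_iff {n : ℕ} (π : Equiv.Perm (Fin n)) :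
    Avoids312 π ↔ listAvoids false (permWord π) := by
  have := avoids_aux (fun i => (π i : ℕ)) (fun x y z => y < x ∧ y < z ∧ outerRel false x z)
  rw [Avoids312, ← not_iff_not, not_not]
  simp only [listAvoids, permWord]
  push Not
  rw [this]
  simp only [outerRel, Bool.false_eq_true, if_false, Fin.lt_def]
  refine exists_congr fun i => exists_congr fun j => exists_congr fun k => ?_
  omega

theorem card_takeWhile {n : ℕ} (f : Fin n → ℕ) (p : ℕ → Bool) :
    Nat.card {j : Fin n // ∀ i ≤ j, p (f i) = true} = ((List.ofFn f).takeWhile p).length := by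
  classical
  induction n with
  | zero => simp
  | succ n ih =>
    rw [List.ofFn_succ, List.takeWhile_cons]
    by_cases h : p (f 0) = true
    · rw [if_pos h, List.length_cons, ← ih]
      rw [Nat.card_eq_fintype_card, Nat.card_eq_fintype_card, Fintype.card_subtype,
        Fintype.card_subtype, Fin.card_filter_univ_succ, if_pos (by simp [h])]
      congr 2
      ext j
      simp [Fin.forall_fin_succ, h]
    · rw [if_neg h]
      simp only [List.length_nil]
      rw [Nat.card_eq_zero]
      left
      exact ⟨fun j => h (j.2 0 (Fin.zero_le _))⟩

theorem jacobi_aux {n : ℕ} (f : Fin n → ℕ) :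
    (∀ k : Fin n, Even (Nat.card {j : Fin n // k < j ∧ ∀ i : Fin n, k < i → i ≤ j → f k < f i}))
      ↔ listJacobi (List.ofFn f) := by
  classical
  induction n with
  | zero => simp [listJacobi]
  | succ n ih =>
    rw [List.ofFn_succ, listJacobi, ← ih, Fin.forall_fin_succ]
    refine and_congr ?_ (forall_congr' fun k => ?_)
    · rw [← card_takeWhile]
      rw [Nat.card_eq_fintype_card, Nat.card_eq_fintype_card, Fintype.card_subtype,
        Fintype.card_subtype, Fin.card_filter_univ_succ, if_neg (by simp)]
      simp [Fin.forall_fin_succ]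
    · rw [Nat.card_eq_fintype_card, Nat.card_eq_fintype_card, Fintype.card_subtype,
        Fintype.card_subtype, Fin.card_filter_univ_succ, if_neg (by simp)]
      simp [Fin.forall_fin_succ]

theorem isJacobi_iff {n : ℕ} (π : Equiv.Perm (Fin n)) :
    IsJacobi π ↔ listJacobi (permWord π) := by
  rw [permWord, ← jacobi_aux]
  rfl

theorem desc_aux {n : ℕ} (f : Fin n → ℕ) :
    Nat.card {k : Fin n // ∃ h : (k : ℕ) + 1 < n, f ⟨(k : ℕ) + 1, h⟩ < f k}
      = listDesc (List.ofFn f) := by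
  classical
  induction n with
  | zero => simp [listDesc]
  | succ n ih =>
    rw [List.ofFn_succ, listDesc, ← ih]
    rw [Nat.card_eq_fintype_card, Nat.card_eq_fintype_card, Fintype.card_subtype,
        Fintype.card_subtype, Fin.card_filter_univ_succ]
    have e : (∃ h : ((0 : Fin (n + 1)) : ℕ) + 1 < n + 1, f ⟨((0 : Fin (n + 1)) : ℕ) + 1, h⟩ < f 0) ↔
        ∃ c ∈ (List.ofFn fun i : Fin n => f i.succ).head?, c < f 0 := by
      cases n with
      | zero =>
        refine ⟨fun ⟨h, _⟩ => ?_, fun ⟨c, hc, _⟩ => by simp at hc⟩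
        have h' : 0 + 1 < 0 + 1 := h
        omega
      | succ n =>
        constructor
        · rintro ⟨h, h2⟩
          exact ⟨f 1, by simp [List.ofFn_succ], h2⟩
        · rintro ⟨c, hc, h2⟩
          simp [List.ofFn_succ] at hc
          subst hc
          exact ⟨by simp, h2⟩
    have e2 : ∀ k : Fin n, (∃ h : ((k.succ : Fin (n + 1)) : ℕ) + 1 < n + 1,
        f ⟨((k.succ : Fin (n + 1)) : ℕ) + 1, h⟩ < f k.succ) ↔
        ∃ h : (k : ℕ) + 1 < n, f (Fin.succ ⟨(k : ℕ) + 1, h⟩) < f k.succ := by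
      intro k
      simp
    simp only [e, e2]
    split_ifs <;> omega

theorem descCount_eq {n : ℕ} (π : Equiv.Perm (Fin n)) :
    descCount π = listDesc (permWord π) := by
  rw [permWord, ← desc_aux]
  rfl

theorem count_eq (b : Bool) (n k : ℕ) :
    Nat.card {π : Equiv.Perm (Fin n) // listJacobi (permWord π) ∧ listAvoids b (permWord π) ∧
      listDesc (permWord π) = k} =
    Set.ncard {T : BinaryTree Unit | T.numNodes = n ∧ treeEven T ∧ treeDesc T = k} := by
  have h1 : Nat.card {π : Equiv.Perm (Fin n) // listJacobi (permWord π) ∧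
      listAvoids b (permWord π) ∧ listDesc (permWord π) = k} =
      Set.ncard {π : Equiv.Perm (Fin n) | listJacobi (permWord π) ∧
      listAvoids b (permWord π) ∧ listDesc (permWord π) = k} := rfl
  rw [h1, ← Set.ncard_image_of_injective _ permWord_inj,
    ← Set.ncard_image_of_injective {T : BinaryTree Unit | _}
      (f := fun T => treeWord b T 0) (fun T T' h => treeWord_inj b T T' 0 h)]
  congr 1
  ext L
  simp only [Set.mem_image, Set.mem_ofPred_eq]
  constructor
  · rintro ⟨π, ⟨hj, ha, hd⟩, rfl⟩
    obtain ⟨T, hT, hn⟩ := exists_tree b n _ 0 (permWord_perm π) ha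
    rw [← hT] at hj hd
    exact ⟨T, ⟨hn, (treeWord_jacobi b T 0).1 hj, by rw [← hd, treeWord_desc]⟩, hT⟩
  · rintro ⟨T, ⟨rfl, he, hd⟩, rfl⟩
    obtain ⟨π, hπ⟩ := permWord_surj _ (treeWord_perm b T 0)
    refine ⟨π, ?_, hπ⟩
    rw [hπ]
    exact ⟨(treeWord_jacobi b T 0).2 he, treeWord_avoids b T 0, by rw [treeWord_desc, hd]⟩

section Lagrange
open Polynomial

set_option linter.unusedSectionVars false
variable {R : Type} [CommRing R] [IsDomain R] [CharZero R]

theorem lagrange_aux (F : PowerSeries R) (φ : R[X]) (r : ℕ)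
    (h : ∀ j : ℕ, (r : R) * PowerSeries.coeff r (F ^ j) = j * (X ^ j * φ ^ r : R[X]).coeff r)
    (p : R[X]) :
    (r : R) * PowerSeries.coeff r (eval₂RingHom PowerSeries.C F p) = (X * derivative p * φ ^ r : R[X]).coeff r := by
  induction p using Polynomial.induction_on' with
  | add p q hp hq =>
    simp only [map_add, mul_add, add_mul, coeff_add, hp, hq]
  | monomial j a =>
    rw [coe_eval₂RingHom, eval₂_monomial, derivative_monomial]
    rw [PowerSeries.coeff_C_mul, mul_left_comm, h]
    cases j with
    | zero => simp
    | succ j =>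
      have e2 : (X * monomial (j + 1 - 1) (a * ((j + 1 : ℕ) : R)) * φ ^ r : R[X]) =
          C (a * ((j + 1 : ℕ) : R)) * (X ^ (j + 1) * φ ^ r) := by
        rw [Nat.add_sub_cancel, ← C_mul_X_pow_eq_monomial]; ring
      rw [e2, coeff_C_mul]; ring

theorem coeff_X_mul_derivative (p : R[X]) (r : ℕ) :
    (X * derivative p).coeff r = r * p.coeff r := by
  cases r with
  | zero => simp
  | succ r => rw [coeff_X_mul, coeff_derivative]; push_cast; ring

theorem lagrange_inversion (F : PowerSeries R) (φ : R[X]) (hF : F = PowerSeries.X * eval₂RingHom PowerSeries.C F φ)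
    (n : ℕ) : ∀ m : ℕ,
    (n : R) * PowerSeries.coeff n (F ^ m) = m * (X ^ m * φ ^ n : R[X]).coeff n := by
  induction n using Nat.strong_induction_on with
  | _ n ih =>
    intro m
    rcases Nat.eq_zero_or_pos m with rfl | hm
    · rcases Nat.eq_zero_or_pos n with rfl | hn
      · simp
      · simp [PowerSeries.coeff_one, hn.ne']
    have hFm : F ^ m = PowerSeries.X ^ m * eval₂RingHom PowerSeries.C F (φ ^ m) := by
      rw [map_pow, ← mul_pow, ← hF]
    rcases lt_or_ge n m with hnm | hnm
    · rw [hFm, PowerSeries.coeff_X_pow_mul', if_neg (by omega), coeff_X_pow_mul',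
        if_neg (by omega)]
      simp
    obtain ⟨r, rfl⟩ := Nat.exists_eq_add_of_le' hnm
    rw [hFm, PowerSeries.coeff_X_pow_mul, coeff_X_pow_mul]
    rcases Nat.eq_zero_or_pos r with rfl | hr
    · have h0 : PowerSeries.constantCoeff F = 0 := by rw [hF]; simp
      have : ∀ p : R[X], PowerSeries.coeff 0 (eval₂RingHom PowerSeries.C F p) = p.coeff 0 := by
        intro p
        induction p using Polynomial.induction_on' with
        | add p q hp hq => simp only [map_add, coeff_add, hp, hq]
        | monomial j a =>
          rw [coe_eval₂RingHom, eval₂_monomial]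
          rw [PowerSeries.coeff_C_mul]
          cases j with
          | zero => simp
          | succ j => simp [h0, coeff_monomial]
      rw [this]; simp
    · have key := lagrange_aux F φ r (ih r (by omega)) (φ ^ m)
      have hr' : (r : R) ≠ 0 := by exact_mod_cast hr.ne'
      apply mul_left_cancel₀ hr'
      rw [mul_left_comm, key, mul_left_comm (r : R), ← coeff_X_mul_derivative]
      obtain ⟨m, rfl⟩ : ∃ m', m = m' + 1 := ⟨m - 1, by omega⟩
      have e : ((r + (m + 1) : ℕ) : R[X]) * (X * derivative (φ ^ (m + 1)) * φ ^ r) =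
          ((m + 1 : ℕ) : R[X]) * (X * derivative (φ ^ (r + (m + 1)))) := by
        rw [derivative_pow, derivative_pow, show r + (m + 1) - 1 = r + m by omega]
        simp only [Nat.add_sub_cancel, C_eq_natCast, pow_add]
        ring
      have := congrArg (fun p : R[X] => p.coeff r) e
      simpa only [← C_eq_natCast, coeff_C_mul] using this

end Lagrange

section GF
open Polynomial

open Classical in
/-- Descent generating polynomial. -/
noncomputable def descPoly (n : ℕ) : ℚ[X] :=
  ∑ T ∈ BinaryTree.treesOfNumNodesEq n, if treeEven T then X ^ treeDesc T else 0

theorem descPoly_coeff (n k : ℕ) : (descPoly n).coeff k =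
    (Set.ncard {T : BinaryTree Unit | T.numNodes = n ∧ treeEven T ∧ treeDesc T = k} : ℚ) := by
  classical
  have : {T : BinaryTree Unit | T.numNodes = n ∧ treeEven T ∧ treeDesc T = k} =
      ((BinaryTree.treesOfNumNodesEq n).filter (fun T => treeEven T ∧ treeDesc T = k) :
        Finset (BinaryTree Unit)) := by
    ext T; simp [BinaryTree.mem_treesOfNumNodesEq]
  rw [this, Set.ncard_coe_finset, descPoly, finsetSum_coeff, Finset.card_filter, Nat.cast_sum]
  refine Finset.sum_congr rfl fun T _ => ?_
  by_cases h : treeEven T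
  · simp [h, coeff_X_pow, eq_comm]
  · simp [h]

theorem descPoly_zero : descPoly 0 = 1 := by
  simp [descPoly, treeEven, treeDesc]

open Finset.HasAntidiagonal (antidiagonal)

theorem descPoly_succ (n : ℕ) : descPoly (n + 1) = ∑ ij ∈ antidiagonal n,
    if Even ij.2 then (if ij.1 = 0 then 1 else X) * descPoly ij.1 * descPoly ij.2 else 0 := by
  classical
  rw [descPoly, BinaryTree.treesOfNumNodesEq_succ, Finset.sum_biUnion]
  · refine Finset.sum_congr rfl fun ij _ => ?_
    rw [BinaryTree.pairwiseNode, Finset.sum_map, Finset.sum_product]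
    by_cases he : Even ij.2
    · rw [if_pos he, descPoly, descPoly, mul_assoc, Finset.sum_mul_sum, Finset.mul_sum]
      refine Finset.sum_congr rfl fun l hl => ?_
      rw [Finset.mul_sum]
      refine Finset.sum_congr rfl fun r hr => ?_
      rw [BinaryTree.mem_treesOfNumNodesEq] at hl hr
      change (if treeEven (.node () l r) then X ^ treeDesc (.node () l r) else 0) = _
      simp only [treeEven, treeDesc, hl, hr, he, and_true]
      by_cases h1 : treeEven l <;> by_cases h2 : treeEven r <;> by_cases h3 : ij.1 = 0 <;>
        simp [h1, h2, h3] <;> ring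
    · rw [if_neg he]
      refine Finset.sum_eq_zero fun l hl => Finset.sum_eq_zero fun r hr => ?_
      rw [BinaryTree.mem_treesOfNumNodesEq] at hl hr
      change (if treeEven (.node () l r) then X ^ treeDesc (.node () l r) else 0) = _
      simp [treeEven, hr, he]
  · simp_rw [Set.PairwiseDisjoint, Set.Pairwise, Finset.disjoint_left]
    aesop

theorem sum_antidiag_even (n : ℕ) (f : ℕ → ℕ → ℚ[X]) :
    (∑ ij ∈ antidiagonal (2 * n), if Even ij.2 then f ij.1 ij.2 else 0) =
      ∑ ij ∈ antidiagonal n, f (2 * ij.1) (2 * ij.2) := by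
  rw [← Finset.sum_filter]
  symm
  refine Finset.sum_nbij' (fun ij => (2 * ij.1, 2 * ij.2)) (fun ij => (ij.1 / 2, ij.2 / 2))
    ?_ ?_ ?_ ?_ ?_
  · rintro ⟨i, j⟩ h; simp at h ⊢; omega
  · rintro ⟨i, j⟩ h; simp [Nat.even_iff] at h ⊢; omega
  · rintro ⟨i, j⟩ h; simp
  · rintro ⟨i, j⟩ h; simp [Nat.even_iff] at h ⊢; omega
  · rintro ⟨i, j⟩ h; simp

theorem sum_antidiag_odd (n : ℕ) (f : ℕ → ℕ → ℚ[X]) :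
    (∑ ij ∈ antidiagonal (2 * n + 1), if Even ij.2 then f ij.1 ij.2 else 0) =
      ∑ ij ∈ antidiagonal n, f (2 * ij.1 + 1) (2 * ij.2) := by
  rw [← Finset.sum_filter]
  symm
  refine Finset.sum_nbij' (fun ij => (2 * ij.1 + 1, 2 * ij.2)) (fun ij => (ij.1 / 2, ij.2 / 2))
    ?_ ?_ ?_ ?_ ?_
  · rintro ⟨i, j⟩ h; simp at h ⊢; omega
  · rintro ⟨i, j⟩ h; simp [Nat.even_iff] at h ⊢; omega
  · rintro ⟨i, j⟩ h; simp; omega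
  · rintro ⟨i, j⟩ h; simp [Nat.even_iff] at h ⊢; omega
  · rintro ⟨i, j⟩ h; simp

/-- Even series without constant term. -/
noncomputable def serF : PowerSeries ℚ[X] :=
  PowerSeries.mk fun n => if n = 0 then 0 else descPoly (2 * n)

noncomputable def serP : PowerSeries ℚ[X] := PowerSeries.mk fun n => descPoly (2 * n + 1)

theorem serF_add : 1 + serF = PowerSeries.mk fun n => descPoly (2 * n) := by
  ext1 n
  cases n with
  | zero => simp [serF, descPoly_zero]
  | succ n => simp [serF, PowerSeries.coeff_one]

theorem serP_eq : serP = (1 + PowerSeries.C X * serF) * (1 + serF) := by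
  ext1 n
  rw [serF_add, serP, PowerSeries.coeff_mk, descPoly_succ,
    sum_antidiag_even n (fun i j => (if i = 0 then 1 else X) * descPoly i * descPoly j),
    PowerSeries.coeff_mul]
  refine Finset.sum_congr rfl fun ij _ => ?_
  rw [PowerSeries.coeff_mk, map_add, PowerSeries.coeff_C_mul, serF, PowerSeries.coeff_mk]
  by_cases h : ij.1 = 0
  · simp [h, descPoly_zero]
  · simp [h, PowerSeries.coeff_one]

theorem serF_eq' : serF = PowerSeries.X * (PowerSeries.C X * serP * (1 + serF)) := by
  ext1 n
  cases n with
  | zero => simp [serF]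
  | succ n =>
    rw [PowerSeries.coeff_succ_X_mul, mul_assoc, PowerSeries.coeff_C_mul, PowerSeries.coeff_mul,
      serF_add, serF, PowerSeries.coeff_mk, if_neg (by omega), show 2 * (n + 1) = (2 * n + 1) + 1 by ring,
      descPoly_succ,
      sum_antidiag_odd n (fun i j => (if i = 0 then 1 else X) * descPoly i * descPoly j),
      Finset.mul_sum]
    refine Finset.sum_congr rfl fun ij _ => ?_
    simp [serP]; ring

noncomputable def phi : ℚ[X][X] := C X * (1 + C X * X) * (1 + X) ^ 2

theorem serF_eq : serF = PowerSeries.X * eval₂RingHom PowerSeries.C serF phi := by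
  have h : eval₂RingHom PowerSeries.C serF phi = PowerSeries.C X * serP * (1 + serF) := by
    rw [serP_eq, phi]
    simp only [map_mul, map_add, map_one, map_pow, coe_eval₂RingHom, eval₂_X, eval₂_C]
    ring
  rw [h]; exact serF_eq'

theorem phi_coeff (n r k : ℕ) : ((phi ^ n).coeff r).coeff k =
    if n ≤ k ∧ k - n ≤ r then (n.choose (k - n) * (2 * n).choose (r - (k - n)) : ℚ) else 0 := by
  have e : phi ^ n = C (X ^ n) * ((1 + X : ℚ[X][X]) ^ n).comp (C X * X) * (1 + X) ^ (2 * n) := by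
    simp only [phi, pow_comp, add_comp, one_comp, X_comp, mul_pow, C_pow, pow_mul]
  rw [e, mul_assoc, coeff_C_mul, coeff_X_pow_mul']
  by_cases hk : n ≤ k
  · rw [if_pos hk]
    obtain ⟨j, rfl⟩ := Nat.exists_eq_add_of_le hk
    simp only [hk, true_and, Nat.add_sub_cancel_left]
    rw [coeff_mul, finsetSum_coeff]
    simp only [comp_C_mul_X_coeff, coeff_one_add_X_pow]
    have : ∀ x ∈ antidiagonal r, (((n.choose x.1 : ℚ[X]) * X ^ x.1 * ((2 * n).choose x.2 : ℚ[X])).coeff j)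
        = if x.1 = j then (n.choose j * (2 * n).choose (r - j) : ℚ) else 0 := by
      rintro ⟨a, c⟩ h
      rw [Finset.HasAntidiagonal.mem_antidiagonal] at h
      simp only at h ⊢
      rw [← C_eq_natCast, ← C_eq_natCast, coeff_mul_C, coeff_C_mul, coeff_X_pow]
      subst h
      by_cases hj : a = j
      · subst hj; simp
      · simp [hj, Ne.symm hj]
    rw [Finset.sum_congr rfl this]
    by_cases hj : j ≤ r
    · rw [if_pos hj, Finset.sum_eq_single (j, r - j)]
      · simp
      · rintro ⟨a, c⟩ h hne
        rw [Finset.HasAntidiagonal.mem_antidiagonal] at h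
        rw [if_neg]
        rintro h2
        apply hne
        simp at h h2 ⊢
        omega
      · intro h
        simp at h
        omega
    · rw [if_neg hj]
      refine Finset.sum_eq_zero ?_
      rintro ⟨a, c⟩ h
      rw [Finset.HasAntidiagonal.mem_antidiagonal] at h
      rw [if_neg]
      simp at h ⊢
      omega
  · rw [if_neg hk, if_neg (by tauto)]

theorem even_count (n k : ℕ) (hn : 1 ≤ n) : (n : ℚ) * (descPoly (2 * n)).coeff k =
    if n ≤ k then (n.choose (k - n) * (2 * n).choose (k + 1) : ℚ) else 0 := by
  have h := lagrange_inversion serF phi serF_eq n 1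
  have h1 : PowerSeries.coeff n (serF ^ 1) = descPoly (2 * n) := by
    simp [serF]; omega
  obtain ⟨m, rfl⟩ : ∃ m, n = m + 1 := ⟨n - 1, by omega⟩
  rw [h1, pow_one, coeff_X_mul, Nat.cast_one, one_mul] at h
  have := congrArg (fun p : ℚ[X] => p.coeff k) h
  simp only [← C_eq_natCast, coeff_C_mul, phi_coeff] at this
  rw [this]
  by_cases hk : m + 1 ≤ k
  · by_cases hk2 : k - (m + 1) ≤ m
    · rw [if_pos ⟨hk, hk2⟩, if_pos hk]
      congr 2
      rw [← Nat.choose_symm (by omega)]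
      congr 1; omega
    · rw [if_neg (by tauto), if_pos hk, Nat.choose_eq_zero_of_lt (n := 2 * (m + 1)) (by omega)]
      simp
  · rw [if_neg (by tauto), if_neg hk]

theorem choose_identity (n j : ℕ) (hj : 1 ≤ j) (hjn : j + 1 ≤ n) :
    ((n : ℚ) + 1) * (n.choose j * (2 * n).choose (n - 1 - j)
      + n.choose (j - 1) * (2 * n).choose (n - j)
      + 2 * (n.choose (j - 1) * (2 * n).choose (n - 1 - j))) =
      n * ((n + 1).choose j * (2 * n).choose (n + j)) := by
  obtain ⟨i, rfl⟩ : ∃ i, j = i + 1 := ⟨j - 1, by omega⟩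
  obtain ⟨m, rfl⟩ : ∃ m, n = i + m + 2 := ⟨n - i - 2, by omega⟩
  have e1 : i + m + 2 - 1 - (i + 1) = m := by omega
  have e2 : i + m + 2 - (i + 1) = m + 1 := by omega
  rw [e1, e2, Nat.add_sub_cancel]
  have e3 : (2 * (i + m + 2)).choose (i + m + 2 + (i + 1)) = (2 * (i + m + 2)).choose (m + 1) := by
    rw [← Nat.choose_symm (by omega)]; congr 1; omega
  rw [e3]
  have a1 := Nat.choose_succ_right_eq (i + m + 2) i
  have a2 := Nat.choose_succ_right_eq (2 * (i + m + 2)) m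
  have a3 := Nat.add_one_mul_choose_eq (i + m + 2) i
  rw [show i + m + 2 - i = m + 2 by omega] at a1
  rw [show 2 * (i + m + 2) - m = 2 * i + m + 4 by omega] at a2
  have b1 : ((i + m + 2).choose (i + 1) : ℚ) = (i + m + 2).choose i * (m + 2) / (i + 1) := by
    rw [eq_div_iff (by positivity)]; exact_mod_cast a1
  have b2 : ((2 * (i + m + 2)).choose (m + 1) : ℚ) =
      (2 * (i + m + 2)).choose m * (2 * i + m + 4) / (m + 1) := by
    rw [eq_div_iff (by positivity)]; exact_mod_cast a2
  have b3 : ((i + m + 2 + 1).choose (i + 1) : ℚ) =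
      (i + m + 2 + 1) * (i + m + 2).choose i / (i + 1) := by
    rw [eq_div_iff (by positivity)]; exact_mod_cast a3.symm
  rw [b1, b2, b3]
  push_cast
  field_simp
  ring

theorem odd_count (n k : ℕ) : ((n : ℚ) + 1) * (descPoly (2 * n + 1)).coeff k =
    if n ≤ k then ((n + 1).choose (k - n) * (2 * n).choose k : ℚ) else 0 := by
  rcases Nat.eq_zero_or_pos n with rfl | hn
  · have : descPoly (2 * 0 + 1) = 1 := by
      rw [descPoly_succ]; simp [descPoly_zero]
    rw [this]
    rcases k with _ | k
    · simp
    · simp [coeff_one]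
  have h1 := lagrange_inversion serF phi serF_eq n 1
  have h2 := lagrange_inversion serF phi serF_eq n 2
  have hP : descPoly (2 * n + 1) = (1 + X) * PowerSeries.coeff n (serF ^ 1) +
      X * PowerSeries.coeff n (serF ^ 2) := by
    have : descPoly (2 * n + 1) = PowerSeries.coeff n serP := by simp [serP]
    rw [this, serP_eq]
    have : (1 + PowerSeries.C X * serF) * (1 + serF) =
        1 + (PowerSeries.C (1 + X) * serF ^ 1 + PowerSeries.C X * serF ^ 2) := by
      rw [map_add, map_one]; ring
    rw [this, map_add, map_add, PowerSeries.coeff_C_mul, PowerSeries.coeff_C_mul,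
      PowerSeries.coeff_one, if_neg hn.ne', zero_add]
  have hn0 : (n : ℚ) ≠ 0 := by exact_mod_cast hn.ne'
  have key : (n : ℚ[X]) * descPoly (2 * n + 1) = (X * phi ^ n : ℚ[X][X]).coeff n +
      X * (X * phi ^ n : ℚ[X][X]).coeff n + X * (2 * (X ^ 2 * phi ^ n : ℚ[X][X]).coeff n) := by
    rw [hP, mul_add, mul_left_comm, h1, mul_left_comm (n : ℚ[X]), h2]
    push_cast; ring
  have key2 : (n : ℚ) * (descPoly (2 * n + 1)).coeff k =
      ((X * phi ^ n : ℚ[X][X]).coeff n).coeff k +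
      (X * (X * phi ^ n : ℚ[X][X]).coeff n).coeff k +
      (X * (C 2 * (X ^ 2 * phi ^ n : ℚ[X][X]).coeff n)).coeff k := by
    have := congrArg (fun p : ℚ[X] => p.coeff k) key
    simpa only [← C_eq_natCast, coeff_C_mul, coeff_add, ← C_ofNat] using this
  have c1 : ∀ k, ((X * phi ^ n : ℚ[X][X]).coeff n).coeff k =
      if n ≤ k ∧ k - n + 1 ≤ n then (n.choose (k - n) * (2 * n).choose (n - 1 - (k - n)) : ℚ)
      else 0 := by
    intro k
    obtain ⟨m, hm⟩ : ∃ m, n = m + 1 := ⟨n - 1, by omega⟩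
    have : (X * phi ^ n : ℚ[X][X]).coeff n = (phi ^ n).coeff (n - 1) := by
      conv_lhs => rw [show n = (n - 1) + 1 by omega]
      rw [coeff_X_mul, show n - 1 + 1 = n by omega]
    rw [this, phi_coeff]
    refine if_congr ?_ rfl rfl
    omega
  have c2 : ∀ k, ((X ^ 2 * phi ^ n : ℚ[X][X]).coeff n).coeff k =
      if n ≤ k ∧ k - n + 2 ≤ n then (n.choose (k - n) * (2 * n).choose (n - 2 - (k - n)) : ℚ)
      else 0 := by
    intro k
    rw [coeff_X_pow_mul']
    by_cases h : 2 ≤ n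
    · rw [if_pos h, phi_coeff]
      refine if_congr ?_ rfl rfl
      omega
    · rw [if_neg h, if_neg (by omega)]; simp
  apply mul_left_cancel₀ hn0
  rw [mul_left_comm, key2]
  by_cases hk : n ≤ k
  swap
  · rw [if_neg hk, c1, if_neg (by tauto)]
    rcases k with _ | k
    · simp
    · rw [coeff_X_mul, coeff_X_mul, coeff_C_mul, c1, c2, if_neg (by omega), if_neg (by omega)]
      simp
  obtain ⟨j, rfl⟩ := Nat.exists_eq_add_of_le hk
  rw [if_pos hk, c1]
  obtain ⟨q, hq⟩ : ∃ q, n + j = q + 1 := ⟨n + j - 1, by omega⟩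
  have d1 : ∀ p : ℚ[X], (X * p).coeff (n + j) = p.coeff (n + j - 1) := by
    intro p; rw [hq, coeff_X_mul, Nat.add_sub_cancel]
  rw [d1, d1, coeff_C_mul, c1, c2]
  rcases Nat.eq_zero_or_pos j with rfl | hj
  · rw [if_pos (by omega), if_neg (by omega), if_neg (by omega)]
    obtain ⟨m, rfl⟩ : ∃ m, n = m + 1 := ⟨n - 1, by omega⟩
    have a2 := Nat.choose_succ_right_eq (2 * (m + 1)) m
    rw [show 2 * (m + 1) - m = m + 2 by omega] at a2
    have a2' : ((2 * (m + 1)).choose (m + 1) : ℚ) * (m + 1) = (2 * (m + 1)).choose m * (m + 2) := by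
      exact_mod_cast a2
    simp
    linarith
  have s1 : n + j - n = j := by omega
  have s2 : n + j - 1 - n = j - 1 := by omega
  rw [s1, s2]
  rcases lt_trichotomy j n with h | h | h
  · rw [if_pos (by omega), if_pos (by omega), if_pos (by omega),
      show n - 1 - (j - 1) = n - j by omega, show n - 2 - (j - 1) = n - 1 - j by omega]
    exact choose_identity n j hj h
  · subst h
    rw [if_neg (by omega), if_pos (by omega), if_neg (by omega)]
    obtain ⟨m, rfl⟩ : ∃ m, j = m + 1 := ⟨j - 1, by omega⟩
    rw [← two_mul, Nat.choose_self]
    simp [Nat.choose_succ_self_right]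
    ring
  · rw [if_neg (by omega), if_neg (by omega), if_neg (by omega),
      Nat.choose_eq_zero_of_lt (n := 2 * n) (by omega)]
    simp

end GF

theorem intChoose_cast (a b : ℕ) : intChoose (a : ℤ) (b : ℤ) = (a.choose b : ℤ) := by
  unfold intChoose
  split_ifs with h
  · simp
  · rw [Nat.choose_eq_zero_of_lt (by omega)]; simp

theorem intChoose_sub (a k n : ℕ) : intChoose (a : ℤ) ((k : ℤ) - (n : ℤ)) =
    if n ≤ k then (a.choose (k - n) : ℤ) else 0 := by
  split_ifs with h
  · rw [← Nat.cast_sub h, intChoose_cast]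
  · unfold intChoose; rw [if_neg (by omega)]

theorem count_even (b : Bool) (n k : ℕ) (hn : 1 ≤ n) :
    (Nat.card {π : Equiv.Perm (Fin (2 * n)) // listJacobi (permWord π) ∧
      listAvoids b (permWord π) ∧ listDesc (permWord π) = k} : ℚ)
        = (1 / (n : ℚ)) * (intChoose (n : ℤ) ((k : ℤ) - (n : ℤ)) : ℤ)
            * (intChoose (2 * (n : ℤ)) ((k : ℤ) + 1) : ℤ) := by
  have hn0 : (n : ℚ) ≠ 0 := by positivity
  have e := even_count n k hn
  have c : intChoose (2 * (n : ℤ)) ((k : ℤ) + 1) = ((2 * n).choose (k + 1) : ℤ) := by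
    rw [← intChoose_cast]; push_cast; rfl
  rw [count_eq, ← descPoly_coeff, c, intChoose_sub]
  apply mul_left_cancel₀ hn0
  rw [e]
  split_ifs
  · push_cast; field_simp
  · simp

theorem count_odd (b : Bool) (n k : ℕ) :
    (Nat.card {π : Equiv.Perm (Fin (2 * n + 1)) // listJacobi (permWord π) ∧
      listAvoids b (permWord π) ∧ listDesc (permWord π) = k} : ℚ)
        = (1 / ((n : ℚ) + 1)) * (intChoose ((n : ℤ) + 1) ((k : ℤ) - (n : ℤ)) : ℤ)
            * (intChoose (2 * (n : ℤ)) (k : ℤ) : ℤ) := by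
  have hn0 : (n : ℚ) + 1 ≠ 0 := by positivity
  have e := odd_count n k
  have c : intChoose (2 * (n : ℤ)) (k : ℤ) = ((2 * n).choose k : ℤ) := by
    rw [← intChoose_cast]; push_cast; rfl
  have c2 := intChoose_sub (n + 1) k n
  rw [Nat.cast_add, Nat.cast_one] at c2
  rw [count_eq, ← descPoly_coeff, c, c2]
  apply mul_left_cancel₀ hn0
  rw [e]
  split_ifs
  · push_cast; field_simp
  · simp

/-- Counting 213- and 312-avoiding Jacobi permutations by descents. -/
theorem jacobi_avoid_213_312_descents :
    (∀ n k : ℕ, 1 ≤ n →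
      (Nat.card {π : Equiv.Perm (Fin (2 * n)) //
          IsJacobi π ∧ Avoids213 π ∧ descCount π = k} : ℚ)
        = (1 / (n : ℚ)) * (intChoose (n : ℤ) ((k : ℤ) - (n : ℤ)) : ℤ)
            * (intChoose (2 * (n : ℤ)) ((k : ℤ) + 1) : ℤ) ∧
      (Nat.card {π : Equiv.Perm (Fin (2 * n)) //
          IsJacobi π ∧ Avoids312 π ∧ descCount π = k} : ℚ)
        = (1 / (n : ℚ)) * (intChoose (n : ℤ) ((k : ℤ) - (n : ℤ)) : ℤ)
            * (intChoose (2 * (n : ℤ)) ((k : ℤ) + 1) : ℤ)) ∧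
    (∀ n k : ℕ,
      (Nat.card {π : Equiv.Perm (Fin (2 * n + 1)) //
          IsJacobi π ∧ Avoids213 π ∧ descCount π = k} : ℚ)
        = (1 / ((n : ℚ) + 1)) * (intChoose ((n : ℤ) + 1) ((k : ℤ) - (n : ℤ)) : ℤ)
            * (intChoose (2 * (n : ℤ)) (k : ℤ) : ℤ) ∧
      (Nat.card {π : Equiv.Perm (Fin (2 * n + 1)) //
          IsJacobi π ∧ Avoids312 π ∧ descCount π = k} : ℚ)
        = (1 / ((n : ℚ) + 1)) * (intChoose ((n : ℤ) + 1) ((k : ℤ) - (n : ℤ)) : ℤ)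
            * (intChoose (2 * (n : ℤ)) (k : ℤ) : ℤ)) := by
  simp only [isJacobi_iff, avoids213_iff, avoids312_iff, descCount_eq]
  exact ⟨fun n k hn => ⟨count_even true n k hn, count_even false n k hn⟩,
    fun n k => ⟨count_odd true n k, count_odd false n k⟩⟩
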